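/- For i = 1, 2 let p_i : Γ_i → Q be surjective homomorphisms, where Γ_1 and Γ_2 are finitely generated and Q is finitely presented, and let P = {(γ_1, γ_2) : p_1(γ_1) = p_2(γ_2)} ≤ Γ_1 × Γ_2 be the fibre product. Then P is finitely generated. Moreover, if α is an isoperimetric function for Q, then for any choice of finite generating sets the distortion function Δ of P in Γ_1 × Γ_2 satisfies Δ ⪯ α. -/

import Mathlib

open Subgroup

/-- Reduced word length in a free group. -/
noncomputable def fgNorm {X : Type*} (w : FreeGroup X) : ℕ :=
  @FreeGroup.norm X (Classical.decEq X) w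

/-- `w` is a product of exactly `N` conjugates of elements of `R ∪ R⁻¹`. -/
def ExprOf {X : Type*} (R : Set (FreeGroup X)) (w : FreeGroup X) (N : ℕ) : Prop :=
  ∃ l : List (FreeGroup X × FreeGroup X),
    l.length = N ∧ (∀ p ∈ l, p.2 ∈ R ∨ p.2⁻¹ ∈ R) ∧
    (l.map fun p => p.1 * p.2 * p.1⁻¹).prod = w

/-- The area of a null-homotopic word: the least number of conjugates of relators needed. -/
noncomputable def area {X : Type*} (R : Set (FreeGroup X)) (w : FreeGroup X) : ℕ :=
  sInf {N | ExprOf R w N}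

/-- The Dehn function of the presentation with relator set `R`. -/
noncomputable def dehn {X : Type*} (R : Set (FreeGroup X)) (l : ℕ) : ℕ :=
  sSup {A | ∃ w ∈ Subgroup.normalClosure R, fgNorm w ≤ l ∧ A = area R w}

/-- `f ⪯ g`. -/
def Preceq (f g : ℕ → ℕ) : Prop := ∃ C : ℕ, ∀ l, f l ≤ C * g (C * l + C) + C * l + C

/-- `f ≃ g`. -/
def FEquiv (f g : ℕ → ℕ) : Prop := Preceq f g ∧ Preceq g f

/-- `φ` realizes `⟨X | R⟩` as a presentation of `G`. -/
def Presents {X : Type*} {G : Type*} [Group G] (R : Set (FreeGroup X))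
    (φ : FreeGroup X →* G) : Prop :=
  Function.Surjective φ ∧ φ.ker = Subgroup.normalClosure R

def FinitelyPresentedGroup (G : Type*) [Group G] : Prop :=
  ∃ (X : Type) (_ : Finite X) (R : Set (FreeGroup X)) (φ : FreeGroup X →* G),
    R.Finite ∧ Presents R φ

/-- `f` is an isoperimetric function for `G` : the Dehn function of every finite
presentation of `G` is `⪯ f`. -/
def IsIsopFunction (G : Type*) [Group G] (f : ℕ → ℕ) : Prop :=
  ∀ (X : Type) (R : Set (FreeGroup X)) (φ : FreeGroup X →* G),
    Finite X → R.Finite → Presents R φ → Preceq (dehn R) f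

/-- `(α, ρ)` is an area-radius pair for the presentation with relator set `R`. -/
def IsAreaRadiusPair {X : Type*} (R : Set (FreeGroup X)) (α ρ : ℕ → ℕ) : Prop :=
  ∀ w ∈ Subgroup.normalClosure R, ∀ l : ℕ, fgNorm w ≤ l →
    ∃ L : List (FreeGroup X × FreeGroup X), L.length ≤ α l ∧
      (∀ p ∈ L, (p.2 ∈ R ∨ p.2⁻¹ ∈ R) ∧ fgNorm p.1 ≤ ρ l) ∧
      (L.map fun p => p.1 * p.2 * p.1⁻¹).prod = w

/-- `g` is a product of at most `k` elements of `S ∪ S⁻¹`. -/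
def WordLe {G : Type*} [Group G] (S : Set G) (g : G) (k : ℕ) : Prop :=
  ∃ l : List G, l.length ≤ k ∧ (∀ x ∈ l, x ∈ S ∨ x⁻¹ ∈ S) ∧ l.prod = g

/-- Word length of `g` with respect to the generating set `S`. -/
noncomputable def wordLength {G : Type*} [Group G] (S : Set G) (g : G) : ℕ :=
  sInf {k | WordLe S g k}

/-- The fibre product of `p₁ : Γ₁ → Q` and `p₂ : Γ₂ → Q`. -/
def fibreProduct {Γ₁ Γ₂ Q : Type} [Group Γ₁] [Group Γ₂] [Group Q]
    (p₁ : Γ₁ →* Q) (p₂ : Γ₂ →* Q) : Subgroup (Γ₁ × Γ₂) where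
  carrier := {x | p₁ x.1 = p₂ x.2}
  one_mem' := by simp
  mul_mem' := by
    intro a b ha hb
    simp only [Set.mem_setOf_eq, Prod.fst_mul, Prod.snd_mul, map_mul] at *
    rw [ha, hb]
  inv_mem' := by
    intro a ha
    simp only [Set.mem_setOf_eq, Prod.fst_inv, Prod.snd_inv, map_inv] at *
    rw [ha]

open FreeGroup (invRev)

section WordLe

variable {G H : Type*} [Group G] [Group H]

theorem WordLe.one (S : Set G) : WordLe S 1 0 := ⟨[], by simp⟩

theorem WordLe.mono {S : Set G} {g : G} {k m : ℕ} (h : WordLe S g k) (hkm : k ≤ m) :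
    WordLe S g m := by
  obtain ⟨l, h₁, h₂, h₃⟩ := h
  exact ⟨l, h₁.trans hkm, h₂, h₃⟩

theorem WordLe.mul {S : Set G} {g h : G} {k m : ℕ} (hg : WordLe S g k) (hh : WordLe S h m) :
    WordLe S (g * h) (k + m) := by
  obtain ⟨l, h₁, h₂, rfl⟩ := hg
  obtain ⟨l', h₁', h₂', rfl⟩ := hh
  refine ⟨l ++ l', by simp; omega, ?_, by simp⟩
  intro x hx
  rcases List.mem_append.1 hx with hx | hx
  exacts [h₂ x hx, h₂' x hx]

theorem WordLe.of_mem {S : Set G} {g : G} (h : g ∈ S) : WordLe S g 1 := ⟨[g], by simp [h]⟩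

theorem WordLe.inv {S : Set G} {g : G} {k : ℕ} (h : WordLe S g k) : WordLe S g⁻¹ k := by
  obtain ⟨l, h₁, h₂, rfl⟩ := h
  refine ⟨(l.map (·⁻¹)).reverse, by simpa using h₁, ?_, by rw [List.prod_inv_reverse]⟩
  intro x hx
  simp only [List.mem_reverse, List.mem_map] at hx
  obtain ⟨y, hy, rfl⟩ := hx
  simpa [or_comm] using h₂ y hy

/-- Words over `S` lift along `ψ` once the elements of `S` do, at a linear cost. -/
theorem WordLe.lift (ψ : H →* G) {U : Set H} {S : Set G} {c : ℕ}
    (hc : ∀ s ∈ S, ∃ p, ψ p = s ∧ WordLe U p c) {g : G} {k : ℕ} (h : WordLe S g k) :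
    ∃ p, ψ p = g ∧ WordLe U p (c * k) := by
  obtain ⟨l, h₁, h₂, rfl⟩ := h
  suffices ∃ p, ψ p = l.prod ∧ WordLe U p (c * l.length) by
    obtain ⟨p, hp, hw⟩ := this
    exact ⟨p, hp, hw.mono (Nat.mul_le_mul_left c h₁)⟩
  clear h₁
  induction l with
  | nil => exact ⟨1, by simp, WordLe.one U⟩
  | cons x l ih =>
    obtain ⟨p, hp, hw⟩ := ih fun y hy => h₂ y (by simp [hy])
    obtain ⟨q, hq, hv⟩ : ∃ q, ψ q = x ∧ WordLe U q c := by
      rcases h₂ x (by simp) with hx | hx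
      · exact hc x hx
      · obtain ⟨q, hq, hv⟩ := hc _ hx
        exact ⟨q⁻¹, by simp [hq], hv.inv⟩
    refine ⟨q * p, by simp [hp, hq], (hv.mul hw).mono ?_⟩
    simp only [List.length_cons]
    linarith [Nat.mul_succ c l.length]

theorem WordLe.map (ψ : H →* G) {U : Set H} {S : Set G} (hUS : ∀ u ∈ U, ψ u ∈ S) {g : H} {k : ℕ}
    (h : WordLe U g k) : WordLe S (ψ g) k := by
  obtain ⟨l, h₁, h₂, rfl⟩ := h
  refine ⟨l.map ψ, by simpa using h₁, ?_, (map_list_prod ψ l).symm⟩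
  intro x hx
  obtain ⟨y, hy, rfl⟩ := List.mem_map.1 hx
  exact (h₂ y hy).imp (hUS y) fun h => map_inv ψ y ▸ hUS _ h

theorem exists_wordLe_of_mem_closure {S : Set G} {g : G} (h : g ∈ closure S) :
    ∃ k, WordLe S g k := by
  induction h using closure_induction with
  | mem x hx => exact ⟨1, .of_mem hx⟩
  | one => exact ⟨0, .one S⟩
  | mul x y _ _ hx hy =>
    obtain ⟨k, hk⟩ := hx
    obtain ⟨m, hm⟩ := hy
    exact ⟨_, hk.mul hm⟩
  | inv x _ hx =>
    obtain ⟨k, hk⟩ := hx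
    exact ⟨_, hk.inv⟩

theorem WordLe.mem_closure {S : Set G} {g : G} {k : ℕ} (h : WordLe S g k) : g ∈ closure S := by
  obtain ⟨l, -, h₂, rfl⟩ := h
  refine list_prod_mem fun x hx => ?_
  rcases h₂ x hx with hx | hx
  · exact subset_closure hx
  · simpa using inv_mem (subset_closure hx : x⁻¹ ∈ closure S)

theorem wordLe_wordLength {S : Set G} (hS : closure S = ⊤) (g : G) :
    WordLe S g (wordLength S g) :=
  Nat.sInf_mem (s := {k | WordLe S g k}) (exists_wordLe_of_mem_closure (by simp [hS]))

theorem WordLe.wordLength_le {S : Set G} {g : G} {k : ℕ} (h : WordLe S g k) :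
    wordLength S g ≤ k :=
  Nat.sInf_le h

end WordLe

theorem Set.Finite.exists_uniform_bound {α : Type*} {s : Set α} (hs : s.Finite)
    {p : α → ℕ → Prop} (hp : ∀ a k m, k ≤ m → p a k → p a m) (h : ∀ a ∈ s, ∃ k, p a k) :
    ∃ C, ∀ a ∈ s, p a C := by
  choose! f hf using h
  obtain ⟨C, hC⟩ := (hs.image f).bddAbove
  exact ⟨C, fun a ha => hp a _ _ (hC ⟨a, ha, rfl⟩) (hf a ha)⟩

/-- Words bounding a planar diagram with at most `n` cells, each labelled by a word in `𝓡`: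
the first boundary edge either is paired with another boundary edge or borders a cell. -/
inductive BoundsDiagram {α : Type*} (𝓡 : Set (List (α × Bool))) : List (α × Bool) → ℕ → Prop
  | nil (n : ℕ) : BoundsDiagram 𝓡 [] n
  | pair (s : α × Bool) {w₁ w₂ : List (α × Bool)} {n₁ n₂ : ℕ} : BoundsDiagram 𝓡 w₁ n₁ →
      BoundsDiagram 𝓡 w₂ n₂ → BoundsDiagram 𝓡 (s :: (w₁ ++ (s.1, !s.2) :: w₂)) (n₁ + n₂)
  | cell {s : α × Bool} {x w : List (α × Bool)} {n : ℕ} : s :: x ∈ 𝓡 →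
      BoundsDiagram 𝓡 (invRev x ++ w) n → BoundsDiagram 𝓡 (s :: w) (n + 1)

namespace BoundsDiagram

variable {α : Type*} {𝓡 : Set (List (α × Bool))}

theorem mono {w : List (α × Bool)} {n m : ℕ} (h : BoundsDiagram 𝓡 w n) (hnm : n ≤ m) :
    BoundsDiagram 𝓡 w m := by
  induction h generalizing m with
  | nil n => exact .nil m
  | @pair s w₁ w₂ n₁ n₂ h₁ _ _ ih₂ =>
    have := pair s h₁ (ih₂ (m := m - n₁) (by omega))
    rwa [Nat.add_sub_cancel' (by omega)] at this
  | @cell s x w n hs _ ih =>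
    have := cell hs (ih (m := m - 1) (by omega))
    rwa [Nat.sub_add_cancel (by omega)] at this

theorem append {w v : List (α × Bool)} {n m : ℕ} (hw : BoundsDiagram 𝓡 w n)
    (hv : BoundsDiagram 𝓡 v m) : BoundsDiagram 𝓡 (w ++ v) (n + m) := by
  induction hw with
  | nil n => exact hv.mono (by omega)
  | @pair s w₁ w₂ n₁ n₂ h₁ _ _ ih₂ =>
    have := pair s h₁ ih₂
    rw [← add_assoc] at this
    simpa using this
  | @cell s x w n hs _ ih =>
    exact (cell hs (by simpa using ih) : BoundsDiagram 𝓡 (s :: (w ++ v)) _).mono (by omega)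

theorem conj_letter (s : α × Bool) {w : List (α × Bool)} {n : ℕ} (h : BoundsDiagram 𝓡 w n) :
    BoundsDiagram 𝓡 (s :: (w ++ [(s.1, !s.2)])) n :=
  pair s h (nil 0)

theorem conj (u : List (α × Bool)) {w : List (α × Bool)} {n : ℕ} (h : BoundsDiagram 𝓡 w n) :
    BoundsDiagram 𝓡 (u ++ w ++ invRev u) n := by
  induction u with
  | nil => simpa using h
  | cons s u ih => simpa [FreeGroup.invRev] using ih.conj_letter s

theorem insert {a b c : List (α × Bool)} {n m : ℕ} (h : BoundsDiagram 𝓡 (a ++ b) n)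
    (hc : BoundsDiagram 𝓡 c m) : BoundsDiagram 𝓡 (a ++ c ++ b) (n + m) := by
  generalize hw : a ++ b = w at h
  induction h generalizing a b with
  | nil n =>
    obtain ⟨rfl, rfl⟩ := List.append_eq_nil_iff.1 hw
    simpa using hc.mono (by omega)
  | @pair s w₁ w₂ n₁ n₂ h₁ h₂ ih₁ ih₂ =>
    rcases a with _ | ⟨s', a⟩
    · simp only [List.nil_append] at hw ⊢
      exact hw ▸ (hc.append (pair s h₁ h₂)).mono (by omega)
    · obtain ⟨rfl, hw⟩ := List.cons.inj hw
      rcases List.append_eq_append_iff.1 hw with ⟨d, rfl, rfl⟩ | ⟨d, rfl, hd⟩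
      · have := pair s' (ih₁ rfl) h₂
        exact (by simpa using this : BoundsDiagram 𝓡 _ _).mono (by omega)
      · rcases d with _ | ⟨s, d⟩
        · simp only [List.nil_append] at hd
          subst hd
          have := pair s' (h₁.append hc) h₂
          exact (by simpa using this : BoundsDiagram 𝓡 _ _).mono (by omega)
        · obtain ⟨rfl, rfl⟩ := List.cons.inj hd
          have := pair s' h₁ (ih₂ rfl)
          exact (by simpa using this : BoundsDiagram 𝓡 _ _).mono (by omega)
  | @cell s x w n hs h ih =>
    rcases a with _ | ⟨s', a⟩
    · simp only [List.nil_append] at hw ⊢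
      exact hw ▸ (hc.append (cell hs h)).mono (by omega)
    · obtain ⟨rfl, rfl⟩ := List.cons.inj hw
      have := ih (a := invRev x ++ a) (b := b) (by simp)
      exact (cell hs (by simpa using this : BoundsDiagram 𝓡 _ (n + m))).mono (by omega)

end BoundsDiagram

/-- A set of words closed under cyclic permutation and formal inversion. -/
structure IsCyclicallyClosed {α : Type*} (𝓡 : Set (List (α × Bool))) : Prop where
  rotate : ∀ u v, u ++ v ∈ 𝓡 → v ++ u ∈ 𝓡
  invRev : ∀ x ∈ 𝓡, invRev x ∈ 𝓡

namespace BoundsDiagram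

variable {α : Type*} {𝓡 : Set (List (α × Bool))}

/-- Attaching a cell along a boundary segment `x` replaces it by a single edge `t`. -/
theorem attach_cell_of_rotate (h𝓡 : IsCyclicallyClosed 𝓡) {m : ℕ}
    (hrot : ∀ u v k, k ≤ m → BoundsDiagram 𝓡 (u ++ v) k → BoundsDiagram 𝓡 (v ++ u) k)
    {u x v : List (α × Bool)} {t : α × Bool} {n : ℕ} (h : BoundsDiagram 𝓡 (u ++ x ++ v) n)
    (hnm : n ≤ m) (ht : t :: invRev x ∈ 𝓡) : BoundsDiagram 𝓡 (u ++ t :: v) (n + 1) := by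
  generalize hw : u ++ x ++ v = w at h
  induction h generalizing u x v with
  | nil n =>
    simp only [List.append_eq_nil_iff] at hw
    obtain ⟨⟨rfl, rfl⟩, rfl⟩ := hw
    exact cell ht (nil n)
  | @pair s w₁ w₂ n₁ n₂ h₁ h₂ ih₁ ih₂ =>
    rcases u with _ | ⟨s', u⟩
    · simp only [List.nil_append] at hw ⊢
      refine cell ht ?_
      rw [FreeGroup.invRev_invRev, hw]
      exact pair s h₁ h₂
    simp only [List.cons_append, List.cons.injEq] at hw
    obtain ⟨rfl, hw⟩ := hw
    have key : ∀ x₁ x₂, w₁ = u ++ x₁ → w₂ = x₂ ++ v → x = x₁ ++ (s'.1, !s'.2) :: x₂ →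
        BoundsDiagram 𝓡 (s' :: u ++ t :: v) (n₁ + n₂ + 1) := by
      rintro x₁ x₂ rfl rfl rfl
      have hr : s' :: (invRev x₁ ++ t :: invRev x₂) ∈ 𝓡 := by
        have := h𝓡.rotate (t :: invRev x₂) (s' :: invRev x₁)
          (by simpa [FreeGroup.invRev] using ht)
        simpa using this
      refine cell hr ?_
      have hins : BoundsDiagram 𝓡 [(t.1, !t.2), t] 0 := by
        simpa using pair (𝓡 := 𝓡) (t.1, !t.2) (nil 0) (nil 0)
      have h₂' := (h₂.insert hins : BoundsDiagram 𝓡 (x₂ ++ [(t.1, !t.2), t] ++ v) _)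
      have h₁' := hrot _ _ _ (by omega) h₁
      have := insert (a := x₂ ++ [(t.1, !t.2)]) (b := t :: v) (by simpa using h₂') h₁'
      have hy : invRev (invRev x₁ ++ t :: invRev x₂) ++ (u ++ t :: v) =
          x₂ ++ [(t.1, !t.2)] ++ (x₁ ++ u) ++ t :: v := by
        rw [FreeGroup.invRev_append, FreeGroup.invRev_cons]
        simp [show invRev [t] = [(t.1, !t.2)] from rfl]
      change BoundsDiagram 𝓡 (invRev _ ++ (u ++ t :: v)) _
      rw [hy]
      exact this.mono (by omega)
    rcases List.append_eq_append_iff.1 hw with ⟨d, rfl, rfl⟩ | ⟨d, hd', hd⟩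
    · have := pair s' (ih₁ (by omega) ht rfl) h₂
      exact (by simpa using this : BoundsDiagram 𝓡 _ _).mono (by omega)
    rcases List.append_eq_append_iff.1 hd' with ⟨x₁, hx₁, hx⟩ | ⟨d', rfl, rfl⟩
    · rcases d with _ | ⟨s, x₂⟩
      · simp only [List.nil_append, List.append_nil] at hd hx
        subst hd hx₁ hx
        have := pair s' (ih₁ (u := u) (v := []) (by omega) ht (by simp)) h₂
        exact (by simpa using this : BoundsDiagram 𝓡 _ _).mono (by omega)
      · simp only [List.cons_append, List.cons.injEq] at hd
        obtain ⟨rfl, hd⟩ := hd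
        exact key x₁ x₂ hx₁ hd hx
    · rcases d' with _ | ⟨s, d'⟩
      · rcases x with _ | ⟨s, x⟩
        · simp only [List.nil_append] at hd
          subst hd
          have := pair s' (ih₁ (u := w₁) (v := []) (x := []) (by omega) ht (by simp)) h₂
          exact (by simpa using this : BoundsDiagram 𝓡 _ _).mono (by omega)
        · simp only [List.nil_append, List.cons_append, List.cons.injEq] at hd
          obtain ⟨rfl, hd⟩ := hd
          exact key [] x (by simp) hd rfl
      · simp only [List.cons_append, List.cons.injEq] at hd
        obtain ⟨rfl, hd⟩ := hd
        have := pair s' h₁ (ih₂ (u := d') (x := x) (v := v) (by omega) ht (by simp [hd]))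
        simpa [add_assoc] using this
  | @cell s y w n hs h ih =>
    rcases u with _ | ⟨s', u⟩
    · simp only [List.nil_append] at hw ⊢
      refine cell ht ?_
      rw [FreeGroup.invRev_invRev, hw]
      exact cell hs h
    · simp only [List.cons_append, List.cons.injEq] at hw
      obtain ⟨rfl, rfl⟩ := hw
      have := ih (u := invRev y ++ u) (x := x) (v := v) (by omega) ht (by simp)
      exact cell hs (by simpa using this)

theorem rotate_of_forall_letter {k : ℕ}
    (h : ∀ t w, BoundsDiagram 𝓡 (t :: w) k → BoundsDiagram 𝓡 (w ++ [t]) k)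
    {u v : List (α × Bool)} (huv : BoundsDiagram 𝓡 (u ++ v) k) :
    BoundsDiagram 𝓡 (v ++ u) k := by
  induction u generalizing v with
  | nil => simpa using huv
  | cons t u ih => simpa using ih (v := v ++ [t]) (by simpa using h _ _ huv)

theorem rotate (h𝓡 : IsCyclicallyClosed 𝓡) {u v : List (α × Bool)} {n : ℕ}
    (h : BoundsDiagram 𝓡 (u ++ v) n) : BoundsDiagram 𝓡 (v ++ u) n := by
  induction n using Nat.strong_induction_on generalizing u v with
  | _ n ih =>
    refine rotate_of_forall_letter (fun t w htw => ?_) h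
    generalize hw : t :: w = w' at htw
    cases htw with
    | nil => simp at hw
    | @pair s w₁ w₂ n₁ n₂ h₁ h₂ =>
      obtain ⟨rfl, rfl⟩ := List.cons.inj hw
      have := h₁.append (h₂.conj_letter (t.1, !t.2))
      simpa using this
    | @cell s x w n hs h =>
      obtain ⟨rfl, rfl⟩ := List.cons.inj hw
      have := attach_cell_of_rotate h𝓡 (m := n) (u := w) (x := invRev x) (v := [])
        (fun u v k hk => ih k (by omega)) (by simpa using ih n (by omega) h) le_rfl
        (by simpa using hs)
      exact this

/-- Capping off a boundary segment that reads a relator by one cell. -/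
theorem cap (h𝓡 : IsCyclicallyClosed 𝓡) {v x : List (α × Bool)} {n : ℕ}
    (h : BoundsDiagram 𝓡 (v ++ x) n) (hx : x ∈ 𝓡) : BoundsDiagram 𝓡 v (n + 1) := by
  generalize hw : v ++ x = w at h
  induction h generalizing v x with
  | nil n =>
    obtain ⟨rfl, rfl⟩ := List.append_eq_nil_iff.1 hw
    exact nil _
  | @pair s w₁ w₂ n₁ n₂ h₁ h₂ ih₁ ih₂ =>
    rcases v with _ | ⟨s', v⟩
    · exact nil _
    simp only [List.cons_append, List.cons.injEq] at hw
    obtain ⟨rfl, hw⟩ := hw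
    have key : ∀ x₁, w₁ = v ++ x₁ → x = x₁ ++ (s'.1, !s'.2) :: w₂ →
        BoundsDiagram 𝓡 (s' :: v) (n₁ + n₂ + 1) := by
      rintro x₁ rfl rfl
      have hr : s' :: (invRev x₁ ++ invRev w₂) ∈ 𝓡 := by
        have := h𝓡.rotate (invRev w₂) (s' :: invRev x₁)
          (by simpa [FreeGroup.invRev] using h𝓡.invRev _ hx)
        simpa using this
      refine cell hr ?_
      have := h₂.append (rotate h𝓡 h₁)
      exact (by simpa using this : BoundsDiagram 𝓡 _ (n₂ + n₁)).mono (by omega)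
    rcases List.append_eq_append_iff.1 hw with ⟨x₁, h₁', hx₁⟩ | ⟨d, rfl, hd⟩
    · exact key x₁ h₁' hx₁
    · rcases d with _ | ⟨s, d⟩
      · exact key [] (by simp) (by simpa using hd.symm)
      · simp only [List.cons_append, List.cons.injEq] at hd
        obtain ⟨rfl, rfl⟩ := hd
        simpa [add_assoc] using pair s' h₁ (ih₂ hx rfl)
  | @cell s y w n hs h ih =>
    rcases v with _ | ⟨s', v⟩
    · exact nil _
    · simp only [List.cons_append, List.cons.injEq] at hw
      obtain ⟨rfl, rfl⟩ := hw
      exact cell hs (ih (v := invRev y ++ v) hx (by simp))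

theorem of_mem (h𝓡 : IsCyclicallyClosed 𝓡) {x : List (α × Bool)} (hx : x ∈ 𝓡) :
    BoundsDiagram 𝓡 x 1 := by
  have h : BoundsDiagram 𝓡 (x ++ invRev x) 0 := by simpa using conj (𝓡 := 𝓡) x (nil 0)
  exact cap h𝓡 h (h𝓡.invRev x hx)

theorem cancel_pair (h𝓡 : IsCyclicallyClosed 𝓡) {s : α × Bool} {v : List (α × Bool)} {n : ℕ}
    (h : BoundsDiagram 𝓡 (s :: (s.1, !s.2) :: v) n) : BoundsDiagram 𝓡 v n := by
  generalize hw : s :: (s.1, !s.2) :: v = w at h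
  cases h with
  | nil => simp at hw
  | @pair s w₁ w₂ n₁ n₂ h₁ h₂ =>
    obtain ⟨rfl, hw⟩ := List.cons.inj hw
    rcases w₁ with _ | ⟨t, w₁⟩
    · simp only [List.nil_append, List.cons.injEq, true_and] at hw
      subst hw
      exact h₂.mono (by omega)
    · simp only [List.cons_append, List.cons.injEq] at hw
      obtain ⟨rfl, rfl⟩ := hw
      have := (rotate h𝓡 (u := [_]) h₁).append h₂
      simpa using this
  | @cell s x w n hs h =>
    obtain ⟨rfl, rfl⟩ := List.cons.inj hw
    have h' := rotate h𝓡 (u := invRev x ++ [(s.1, !s.2)]) (v := v) (by simpa using h)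
    exact cap h𝓡 h' (by simpa [FreeGroup.invRev] using h𝓡.invRev _ hs)

theorem red (h𝓡 : IsCyclicallyClosed 𝓡) {w v : List (α × Bool)} {n : ℕ}
    (h : BoundsDiagram 𝓡 w n) (hwv : FreeGroup.Red w v) : BoundsDiagram 𝓡 v n := by
  induction hwv with
  | refl => exact h
  | tail _ hs ih =>
    rcases hs with @⟨L₁, L₂, x, b⟩
    have := cancel_pair h𝓡 (s := (x, b)) (v := L₂ ++ L₁) (by simpa using rotate h𝓡 ih)
    exact rotate h𝓡 this

end BoundsDiagram

/-- All cyclic permutations of the reduced words representing elements of `R ∪ R⁻¹`. -/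
def cyclicRelators {α : Type*} [DecidableEq α] (R : Set (FreeGroup α)) :
    Set (List (α × Bool)) :=
  {x | ∃ r, (r ∈ R ∨ r⁻¹ ∈ R) ∧ x ~r r.toWord}

theorem isCyclicallyClosed_cyclicRelators {α : Type*} [DecidableEq α] (R : Set (FreeGroup α)) :
    IsCyclicallyClosed (cyclicRelators R) where
  rotate := by
    rintro u v ⟨r, hr, h⟩
    exact ⟨r, hr, List.isRotated_append.trans h⟩
  invRev := by
    rintro x ⟨r, hr, h⟩
    refine ⟨r⁻¹, by simpa [or_comm] using hr, ?_⟩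
    rw [FreeGroup.toWord_inv]
    exact (h.map _).reverse

theorem ExprOf.boundsDiagram {α : Type*} [DecidableEq α] {R : Set (FreeGroup α)}
    {w : FreeGroup α} {N : ℕ} (h : ExprOf R w N) :
    BoundsDiagram (cyclicRelators R) w.toWord N := by
  have h𝓡 := isCyclicallyClosed_cyclicRelators R
  have hmul : ∀ a b : FreeGroup α, FreeGroup.Red (a.toWord ++ b.toWord) (a * b).toWord := by
    intro a b
    rw [FreeGroup.toWord_mul]
    exact FreeGroup.reduce.red
  obtain ⟨l, rfl, hl, rfl⟩ := h
  induction l with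
  | nil => simpa using BoundsDiagram.nil 0
  | cons p l ih =>
    have ih := ih fun q hq => hl q (by simp [hq])
    have hp := BoundsDiagram.of_mem h𝓡 (x := p.2.toWord)
      ⟨p.2, hl p (by simp), List.IsRotated.refl _⟩
    have hc : BoundsDiagram (cyclicRelators R) (p.1 * p.2 * p.1⁻¹).toWord 1 := by
      refine (hp.conj p.1.toWord).red h𝓡 (.trans (FreeGroup.Red.append_append (hmul _ _) .refl) ?_)
      rw [← FreeGroup.toWord_inv]
      exact hmul _ _
    have := (hc.append ih).red h𝓡 (hmul _ _)
    simpa [add_comm] using this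

section Semantics

variable {α G : Type*} [Group G]

theorem wordLe_map_mk {S : Set G} (d : FreeGroup α →* G) (hd : ∀ a, d (.of a) ∈ S)
    (u : List (α × Bool)) : WordLe S (d (.mk u)) u.length := by
  induction u with
  | nil => simpa [← FreeGroup.one_eq_mk] using WordLe.one S
  | cons s u ih =>
    have hs : WordLe S (d (.mk [s])) 1 := by
      rcases s with ⟨a, _ | _⟩
      · have : FreeGroup.mk [(a, false)] = (FreeGroup.of a)⁻¹ := rfl
        rw [this, map_inv]
        exact (WordLe.of_mem (hd a)).inv
      · exact WordLe.of_mem (hd a)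
    have : FreeGroup.mk (s :: u) = .mk [s] * .mk u := rfl
    rw [this, map_mul]
    exact (hs.mul ih).mono (by simp [add_comm])

theorem BoundsDiagram.wordLe {𝓡 : Set (List (α × Bool))} {S : Set G} {d j : FreeGroup α →* G}
    (hd : ∀ a, d (.of a) ∈ S) (hdj : ∀ u v, d u * j v * (d u)⁻¹ = j (u * v * u⁻¹)) {M : ℕ}
    (hM : ∀ x ∈ 𝓡, x.length ≤ M ∧ WordLe S (j (.mk x)) M) {w : List (α × Bool)} {n : ℕ}
    (h : BoundsDiagram 𝓡 w n) : WordLe S (j (.mk w)) (2 * M * n + w.length) := by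
  induction h with
  | nil n => simpa [← FreeGroup.one_eq_mk] using (WordLe.one S).mono (Nat.zero_le (2 * M * n))
  | @pair s w₁ w₂ n₁ n₂ _ _ ih₁ ih₂ =>
    have hs := wordLe_map_mk d hd [s]
    have : FreeGroup.mk (s :: (w₁ ++ (s.1, !s.2) :: w₂)) =
        (.mk [s] * .mk w₁ * (.mk [s])⁻¹) * .mk w₂ := by
      simp [FreeGroup.invRev]
    rw [this, map_mul, ← hdj]
    refine (((hs.mul ih₁).mul hs.inv).mul ih₂).mono ?_
    simp only [List.length_cons, List.length_nil, List.length_append]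
    linarith
  | @cell s x w n hs _ ih =>
    have : FreeGroup.mk (s :: w) = .mk (s :: x) * .mk (FreeGroup.invRev x ++ w) := by
      rw [← FreeGroup.mul_mk, ← FreeGroup.inv_mk,
        show FreeGroup.mk (s :: x) = .mk [s] * .mk x from rfl, mul_assoc, mul_inv_cancel_left]
      rfl
    obtain ⟨hl, hw⟩ := hM _ hs
    rw [this, map_mul]
    refine (hw.mul ih).mono ?_
    simp only [List.length_cons, List.length_append, FreeGroup.invRev_length] at hl ⊢
    linarith

theorem wordLe_of_mem_cyclicRelators [DecidableEq α] {R : Set (FreeGroup α)} {S : Set G}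
    {d j : FreeGroup α →* G} (hd : ∀ a, d (.of a) ∈ S) (hj : ∀ r ∈ R, j r ∈ S)
    (hdj : ∀ u v, d u * j v * (d u)⁻¹ = j (u * v * u⁻¹)) {M : ℕ} (hM : ∀ r ∈ R, r.norm ≤ M)
    {x : List (α × Bool)} (hx : x ∈ cyclicRelators R) :
    x.length ≤ 2 * M + 1 ∧ WordLe S (j (.mk x)) (2 * M + 1) := by
  obtain ⟨r, hr, hxr⟩ := hx
  have hrM : r.toWord.length ≤ M := by
    rcases hr with hr | hr
    · exact hM r hr
    · simpa [FreeGroup.norm] using hM _ hr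
  have hjr : WordLe S (j r) 1 := by
    rcases hr with hr | hr
    · exact .of_mem (hj r hr)
    · simpa using (WordLe.of_mem (hj _ hr)).inv
  refine ⟨by rw [hxr.perm.length_eq]; omega, ?_⟩
  obtain ⟨k, hk, hkx⟩ := List.isRotated_iff_mod.1 hxr.symm
  rw [List.rotate_eq_drop_append_take hk] at hkx
  have hsplit : r = FreeGroup.mk (r.toWord.take k) * .mk (r.toWord.drop k) := by
    rw [FreeGroup.mul_mk, List.take_append_drop, FreeGroup.mk_toWord]
  set u := FreeGroup.mk (r.toWord.take k) with hu
  have hx : FreeGroup.mk x = u⁻¹ * r * u⁻¹⁻¹ := by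
    rw [← hkx, ← FreeGroup.mul_mk, ← hu]
    conv_rhs => rw [hsplit]
    group
  have hdu : WordLe S (d u) M :=
    (wordLe_map_mk d hd (r.toWord.take k)).mono (by simp; omega)
  rw [hx, ← hdj, map_inv]
  exact ((hdu.inv.mul hjr).mul hdu.inv.inv).mono (by omega)

/-- If `j` is equivariant for conjugation through `d`, then `j` of a product of `N` conjugates of
relators is short in terms of `N` and the length of the product, regardless of the conjugators. -/
theorem exists_wordLe_of_exprOf [DecidableEq α] {R : Set (FreeGroup α)} (hR : R.Finite)
    {S : Set G} {d j : FreeGroup α →* G} (hd : ∀ a, d (.of a) ∈ S) (hj : ∀ r ∈ R, j r ∈ S)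
    (hdj : ∀ u v, d u * j v * (d u)⁻¹ = j (u * v * u⁻¹)) :
    ∃ K, ∀ w N, ExprOf R w N → WordLe S (j w) (K * N + w.norm) := by
  obtain ⟨M, hM⟩ := hR.exists_uniform_bound (p := fun r k => r.norm ≤ k)
    (fun _ _ _ h h' => h'.trans h) fun r _ => ⟨_, le_rfl⟩
  refine ⟨2 * (2 * M + 1), fun w N h => ?_⟩
  have := h.boundsDiagram.wordLe hd hdj
    fun x hx => wordLe_of_mem_cyclicRelators hd hj hdj hM hx
  rwa [FreeGroup.mk_toWord] at this

end Semantics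

section Presentation

variable {X Q : Type*} [Group Q]

theorem exists_exprOf {R : Set (FreeGroup X)} {w : FreeGroup X} (hw : w ∈ normalClosure R) :
    ∃ N, ExprOf R w N := by
  induction hw using closure_induction with
  | mem x hx =>
    obtain ⟨r, hr, hx⟩ := Group.mem_conjugatesOfSet_iff.1 hx
    obtain ⟨c, rfl⟩ := isConj_iff.1 hx
    exact ⟨1, [(c, r)], by simp [hr]⟩
  | one => exact ⟨0, [], by simp⟩
  | mul x y _ _ hx hy =>
    obtain ⟨N, l, -, h, rfl⟩ := hx
    obtain ⟨N', l', -, h', rfl⟩ := hy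
    refine ⟨_, l ++ l', rfl, fun p hp => ?_, by simp⟩
    exact (List.mem_append.1 hp).elim (h p) (h' p)
  | inv x _ hx =>
    obtain ⟨N, l, -, h, rfl⟩ := hx
    refine ⟨_, (l.map fun p => (p.1, p.2⁻¹)).reverse, rfl, ?_, ?_⟩
    · intro p hp
      obtain ⟨q, hq, rfl⟩ := List.mem_map.1 (List.mem_reverse.1 hp)
      simpa [or_comm] using h q hq
    · rw [List.prod_inv_reverse, List.map_reverse, List.map_map, List.map_map]
      congr 3
      funext p
      simp [mul_assoc]

theorem exprOf_area {R : Set (FreeGroup X)} {w : FreeGroup X} (hw : w ∈ normalClosure R) :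
    ExprOf R w (area R w) :=
  Nat.sInf_mem (s := {N | ExprOf R w N}) (exists_exprOf hw)

theorem finite_fgNorm_le [Finite X] (l : ℕ) : {w : FreeGroup X | fgNorm w ≤ l}.Finite := by
  let _ : DecidableEq X := Classical.decEq X
  exact (List.finite_length_le (X × Bool) l).preimage FreeGroup.toWord_injective.injOn

theorem area_le_dehn [Finite X] {R : Set (FreeGroup X)} {w : FreeGroup X}
    (hw : w ∈ normalClosure R) {l : ℕ} (hl : fgNorm w ≤ l) : area R w ≤ dehn R l := by
  refine le_csSup (Set.Finite.bddAbove ?_) ⟨w, hw, hl, rfl⟩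
  refine ((finite_fgNorm_le l).image (area R)).subset ?_
  rintro _ ⟨v, -, hv, rfl⟩
  exact ⟨v, hv, rfl⟩

theorem lift_elim_of_map_inl {Y : Type*} (u : Y → FreeGroup X) (v : FreeGroup X) :
    FreeGroup.lift (Sum.elim FreeGroup.of u) (FreeGroup.map Sum.inl v) = v := by
  rw [← MonoidHom.comp_apply]
  conv_rhs => rw [← MonoidHom.id_apply (FreeGroup X) v]
  congr 1
  ext x
  simp

/-- Adjoining redundant generators `y`, with relators identifying `y` with `u y`. -/
theorem Presents.adjoin {Y : Type*} {R : Set (FreeGroup X)} {φ : FreeGroup X →* Q}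
    (h : Presents R φ) (u : Y → FreeGroup X) :
    Presents (FreeGroup.map Sum.inl '' R ∪
        Set.range fun y => FreeGroup.map Sum.inl (u y) * (FreeGroup.of (Sum.inr y))⁻¹)
      (φ.comp (FreeGroup.lift (Sum.elim .of u))) := by
  set R' := FreeGroup.map Sum.inl '' R ∪
    Set.range fun y => FreeGroup.map Sum.inl (u y) * (FreeGroup.of (Sum.inr y))⁻¹
  set σ : FreeGroup (X ⊕ Y) →* FreeGroup X := FreeGroup.lift (Sum.elim .of u) with hσ
  have hσ_inl : ∀ v, σ (FreeGroup.map Sum.inl v) = v := lift_elim_of_map_inl u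
  refine ⟨fun q => ?_, le_antisymm (fun w hw => ?_) (normalClosure_le_normal ?_)⟩
  · obtain ⟨v, rfl⟩ := h.1 q
    exact ⟨FreeGroup.map Sum.inl v, by simp [hσ_inl]⟩
  · have hmk : (QuotientGroup.mk' (normalClosure R')).comp ((FreeGroup.map Sum.inl).comp σ) =
        QuotientGroup.mk' (normalClosure R') := by
      ext z
      rcases z with x | y
      · simp [hσ]
      · have : FreeGroup.map Sum.inl (u y) * (FreeGroup.of (Sum.inr y))⁻¹ ∈ normalClosure R' :=
          subset_normalClosure (.inr ⟨y, rfl⟩)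
        rw [← QuotientGroup.eq_one_iff] at this
        simpa [hσ, mul_inv_eq_one] using this
    have hσw : σ w ∈ normalClosure R := by
      rw [← h.2]
      exact hw
    have : FreeGroup.map Sum.inl (σ w) ∈ normalClosure R' := by
      have := map_normalClosure_le R (FreeGroup.map (Sum.inl : X → X ⊕ Y))
        (mem_map_of_mem _ hσw)
      exact normalClosure_mono Set.subset_union_left this
    rw [← QuotientGroup.eq_one_iff] at this ⊢
    rw [← this]
    exact (DFunLike.congr_fun hmk w).symm
  · rintro _ (⟨r, hr, rfl⟩ | ⟨y, rfl⟩)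
    · have : r ∈ φ.ker := h.2 ▸ subset_normalClosure hr
      simpa [MonoidHom.mem_ker, hσ_inl] using this
    · have hy : σ (.of (.inr y)) = u y := by simp [hσ]
      change φ (σ (_ * _)) = 1
      rw [map_mul, map_inv, hσ_inl, hy, mul_inv_cancel, map_one]

theorem ExprOf.split {X₁ X₂ : Type*} {R : Set (FreeGroup X)} {R₁ : Set (FreeGroup X₁)}
    {R₂ : Set (FreeGroup X₂)} {θ₁ : FreeGroup X →* FreeGroup X₁}
    {θ₂ : FreeGroup X →* FreeGroup X₂}
    (hθ : ∀ r ∈ R, θ₁ r ∈ R₁ ∧ θ₂ r = 1 ∨ θ₁ r = 1 ∧ θ₂ r ∈ R₂) {w : FreeGroup X} {N : ℕ}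
    (h : ExprOf R w N) :
    ∃ N₁ N₂, N₁ + N₂ = N ∧ ExprOf R₁ (θ₁ w) N₁ ∧ ExprOf R₂ (θ₂ w) N₂ := by
  obtain ⟨l, rfl, hl, rfl⟩ := h
  induction l with
  | nil => exact ⟨0, 0, rfl, ⟨[], by simp⟩, ⟨[], by simp⟩⟩
  | cons p l ih =>
    obtain ⟨_, _, hN, ⟨l₁, rfl, hl₁, hp₁⟩, l₂, rfl, hl₂, hp₂⟩ :=
      ih fun q hq => hl q (by simp [hq])
    have hp : (θ₁ p.2 ∈ R₁ ∨ (θ₁ p.2)⁻¹ ∈ R₁) ∧ θ₂ p.2 = 1 ∨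
        θ₁ p.2 = 1 ∧ (θ₂ p.2 ∈ R₂ ∨ (θ₂ p.2)⁻¹ ∈ R₂) := by
      rcases hl p (by simp) with hp | hp
      · have := hθ _ hp
        tauto
      · have := hθ _ hp
        simp only [map_inv, inv_eq_one] at this
        tauto
    rcases hp with ⟨hp, hp'⟩ | ⟨hp', hp⟩
    · refine ⟨_, _, ?_, ⟨(θ₁ p.1, θ₁ p.2) :: l₁, rfl, ?_, ?_⟩, l₂, rfl, hl₂, ?_⟩
      · simp only [List.length_cons]
        omega
      · simpa [hp] using hl₁
      · simp [hp₁]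
      · simp [hp₂, hp']
    · refine ⟨_, _, ?_, ⟨l₁, rfl, hl₁, ?_⟩, (θ₂ p.1, θ₂ p.2) :: l₂, rfl, ?_, ?_⟩
      · simp only [List.length_cons]
        omega
      · simp [hp₁, hp']
      · simpa [hp] using hl₂
      · simp [hp₂]

theorem ExprOf.area_le {R : Set (FreeGroup X)} {w : FreeGroup X} {N : ℕ} (h : ExprOf R w N) :
    area R w ≤ N :=
  Nat.sInf_le h

theorem ExprOf.area_map_le {X' : Type*} {R : Set (FreeGroup X)} {R' : Set (FreeGroup X')}
    {θ : FreeGroup X →* FreeGroup X'} (hθ : ∀ r ∈ R, θ r ∈ R' ∨ θ r = 1) {w : FreeGroup X}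
    {N : ℕ} (h : ExprOf R w N) : area R' (θ w) ≤ N := by
  obtain ⟨N₁, N₂, hN, h₁, -⟩ := h.split (R₁ := R') (R₂ := Set.univ) (θ₁ := θ)
    (θ₂ := (1 : FreeGroup X →* FreeGroup X)) fun r hr => by simpa using hθ r hr
  exact h₁.area_le.trans (by omega)

theorem ExprOf.natAbs_le {R : Set (FreeGroup X)} {e : FreeGroup X →* Multiplicative ℤ}
    (he : ∀ r ∈ R, (e r).toAdd.natAbs ≤ 1) {w : FreeGroup X} {N : ℕ} (h : ExprOf R w N) :
    (e w).toAdd.natAbs ≤ N := by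
  obtain ⟨l, rfl, hl, rfl⟩ := h
  induction l with
  | nil => simp
  | cons p l ih =>
    have ih := ih fun q hq => hl q (by simp [hq])
    have hp : (e p.2).toAdd.natAbs ≤ 1 := by
      rcases hl p (by simp) with hp | hp
      · exact he _ hp
      · simpa using he _ hp
    simp only [List.map_cons, List.prod_cons, map_mul, map_inv, mul_inv_cancel_comm, toAdd_mul,
      List.length_cons]
    exact (Int.natAbs_add_le _ _).trans (by omega)

theorem fgNorm_map_le {X' : Type*} (f : X → X') (w : FreeGroup X) :
    fgNorm (FreeGroup.map f w) ≤ fgNorm w := by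
  let _ : DecidableEq X := Classical.decEq X
  let _ : DecidableEq X' := Classical.decEq X'
  have : FreeGroup.map f w = .mk (w.toWord.map fun s => (f s.1, s.2)) := by
    conv_lhs => rw [← FreeGroup.mk_toWord (x := w)]
    rfl
  change (FreeGroup.map f w).norm ≤ w.norm
  rw [this]
  exact FreeGroup.norm_mk_le.trans (by simp [FreeGroup.norm])

theorem exists_fgNorm_le_of_fgNorm_le_mul {X' : Type*} {K : ℕ}
    {θ : FreeGroup X' →* FreeGroup X}
    (hθ : ∀ v : FreeGroup X, fgNorm v ≤ K → ∃ y, θ (.of y) = v) {l : ℕ} {w : FreeGroup X}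
    (hw : fgNorm w ≤ K * l) : ∃ w', fgNorm w' ≤ l ∧ θ w' = w := by
  let _ : DecidableEq X := Classical.decEq X
  let _ : DecidableEq X' := Classical.decEq X'
  induction l generalizing w with
  | zero =>
    have : w.norm = 0 := Nat.le_zero.1 hw
    exact ⟨1, by simp [fgNorm], by simp [FreeGroup.norm_eq_zero.1 this]⟩
  | succ l ih =>
    have hlen : w.toWord.length ≤ K * l + K := hw
    obtain ⟨y, hy⟩ := hθ (.mk (w.toWord.take K))
      (FreeGroup.norm_mk_le.trans (List.length_take_le _ _))
    obtain ⟨w', hw', hθw'⟩ := ih (w := .mk (w.toWord.drop K))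
      (FreeGroup.norm_mk_le.trans (by rw [List.length_drop]; omega))
    refine ⟨.of y * w', (FreeGroup.norm_mul_le _ _).trans ?_, ?_⟩
    · have : w'.norm ≤ l := hw'
      rw [FreeGroup.norm_of]
      omega
    · rw [map_mul, hy, hθw', FreeGroup.mul_mk, List.take_append_drop, FreeGroup.mk_toWord]

theorem Presents.exists_dehn_mul_le {X Q : Type} [Group Q] [Finite X] {R : Set (FreeGroup X)}
    {φ : FreeGroup X →* Q} (hR : R.Finite) (h : Presents R φ) (K : ℕ) :
    ∃ (X' : Type) (_ : Finite X') (R' : Set (FreeGroup X')) (φ' : FreeGroup X' →* Q),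
      R'.Finite ∧ Presents R' φ' ∧ ∀ l, dehn R (K * l) ≤ dehn R' l ∧ l ≤ dehn R' l := by
  let Y := {v : FreeGroup X | fgNorm v ≤ K}
  have : Finite Y := finite_fgNorm_le K
  have hP := h.adjoin (Y := Y) Subtype.val
  refine ⟨X ⊕ Y, inferInstance, _, _, (hR.image _).union (Set.finite_range _), hP, fun l =>
    ⟨?_, ?_⟩⟩
  · refine csSup_le' ?_
    rintro _ ⟨w, hw, hwl, rfl⟩
    obtain ⟨w', hw'l, rfl⟩ := exists_fgNorm_le_of_fgNorm_le_mul
      (θ := FreeGroup.lift (Sum.elim FreeGroup.of (Subtype.val : Y → FreeGroup X)))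
      (fun v hv => ⟨Sum.inr ⟨v, hv⟩, by simp⟩) hwl
    have hw' := hw
    rw [← h.2, MonoidHom.mem_ker, ← MonoidHom.comp_apply, ← MonoidHom.mem_ker, hP.2] at hw'
    refine ((exprOf_area hw').area_map_le ?_).trans (area_le_dehn hw' hw'l)
    rintro _ (⟨r, hr, rfl⟩ | ⟨y, rfl⟩)
    · left
      rwa [lift_elim_of_map_inl]
    · right
      rw [map_mul, map_inv, lift_elim_of_map_inl, FreeGroup.lift_apply_of, Sum.elim_inr,
        mul_inv_cancel]
  · classical
    let y : FreeGroup (X ⊕ Y) := .of (.inr ⟨1, by simp [Y, fgNorm]⟩)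
    let e : FreeGroup (X ⊕ Y) →* Multiplicative ℤ :=
      FreeGroup.lift (Sum.elim 1 fun v => if v.1 = 1 then .ofAdd 1 else 1)
    have he_inl : ∀ v, e (FreeGroup.map Sum.inl v) = 1 := by
      intro v
      rw [← MonoidHom.comp_apply]
      conv_rhs => rw [← MonoidHom.one_apply (N := Multiplicative ℤ) v]
      congr 1
      ext x
      simp [e]
    have hy : y ^ l ∈ normalClosure (FreeGroup.map Sum.inl '' R ∪ Set.range fun v : Y =>
        FreeGroup.map Sum.inl v.1 * (FreeGroup.of (Sum.inr v))⁻¹) := by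
      rw [← hP.2, MonoidHom.mem_ker]
      simp [y]
    have hnorm : fgNorm (y ^ l) ≤ l := by
      let _ : DecidableEq (X ⊕ Y) := Classical.decEq _
      change FreeGroup.norm _ ≤ l
      rw [FreeGroup.norm_of_pow]
    refine le_trans ?_ (area_le_dehn hy hnorm)
    have := (exprOf_area hy).natAbs_le (e := e) ?_
    · simpa [e, y] using this
    · rintro _ (⟨r, hr, rfl⟩ | ⟨v, rfl⟩)
      · simp [he_inl]
      · rw [map_mul, he_inl, one_mul, map_inv]
        by_cases hv : v.1 = 1 <;> simp [e, hv]

theorem Presents.exists_two_mul_dehn_le {X Q : Type} [Group Q] [Finite X]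
    {R : Set (FreeGroup X)} {φ : FreeGroup X →* Q} (hR : R.Finite) (h : Presents R φ) :
    ∃ (X' : Type) (_ : Finite X') (R' : Set (FreeGroup X')) (φ' : FreeGroup X' →* Q),
      R'.Finite ∧ Presents R' φ' ∧ ∀ l, 2 * dehn R l ≤ dehn R' l := by
  have : Finite R := hR
  let R' : Set (FreeGroup (X ⊕ R)) :=
    (Set.range fun r : R => FreeGroup.map Sum.inl r.1 * (FreeGroup.of (Sum.inr r))⁻¹) ∪
      Set.range fun r => FreeGroup.of (Sum.inr r)
  have hmem₁ : ∀ r : R, FreeGroup.map Sum.inl r.1 * (FreeGroup.of (Sum.inr r))⁻¹ ∈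
      normalClosure R' := fun r => subset_normalClosure (.inl ⟨r, rfl⟩)
  have hmem₂ : ∀ r : R, FreeGroup.of (Sum.inr r) ∈ normalClosure R' :=
    fun r => subset_normalClosure (.inr ⟨r, rfl⟩)
  have hmem : ∀ r ∈ R, FreeGroup.map Sum.inl r ∈ normalClosure R' := fun r hr => by
    simpa using mul_mem (hmem₁ ⟨r, hr⟩) (hmem₂ ⟨r, hr⟩)
  have hP := h.adjoin (Y := R) Subtype.val
  have hclosure : normalClosure (FreeGroup.map Sum.inl '' R ∪ Set.range fun r : R =>
      FreeGroup.map Sum.inl r.1 * (FreeGroup.of (Sum.inr r))⁻¹) = normalClosure R' := by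
    refine le_antisymm (normalClosure_le_normal ?_) (normalClosure_le_normal ?_)
    · rintro _ (⟨r, hr, rfl⟩ | ⟨r, rfl⟩)
      exacts [hmem r hr, hmem₁ r]
    · rintro _ (⟨r, rfl⟩ | ⟨r, rfl⟩)
      · exact subset_normalClosure (.inr ⟨r, rfl⟩)
      · rw [← hP.2]
        have : r.1 ∈ φ.ker := h.2 ▸ subset_normalClosure r.2
        simpa using this
  refine ⟨X ⊕ R, inferInstance, R', _, (Set.finite_range _).union (Set.finite_range _),
    ⟨hP.1, hP.2.trans hclosure⟩, fun l => ?_⟩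
  have : dehn R l ≤ dehn R' l / 2 := by
    refine csSup_le' ?_
    rintro _ ⟨w, hw, hwl, rfl⟩
    have hw' : FreeGroup.map Sum.inl w ∈ normalClosure R' := by
      have : R ⊆ (normalClosure R').comap (FreeGroup.map Sum.inl) := hmem
      exact normalClosure_le_normal this hw
    obtain ⟨N₁, N₂, hN, h₁, h₂⟩ := (exprOf_area hw').split (R₁ := R) (R₂ := R)
      (θ₁ := FreeGroup.lift (Sum.elim .of Subtype.val))
      (θ₂ := FreeGroup.lift (Sum.elim .of fun _ => 1)) (by
        rintro _ (⟨r, rfl⟩ | ⟨r, rfl⟩)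
        · right
          simp only [map_mul, map_inv, lift_elim_of_map_inl, FreeGroup.lift_apply_of]
          simp
        · left
          simp)
    rw [lift_elim_of_map_inl] at h₁ h₂
    have := area_le_dehn hw' ((fgNorm_map_le _ w).trans hwl)
    have := h₁.area_le
    have := h₂.area_le
    omega
  omega

theorem Presents.exists_two_pow_mul_dehn_le {X Q : Type} [Group Q] [Finite X]
    {R : Set (FreeGroup X)} {φ : FreeGroup X →* Q} (hR : R.Finite) (h : Presents R φ) (k : ℕ) :
    ∃ (X' : Type) (_ : Finite X') (R' : Set (FreeGroup X')) (φ' : FreeGroup X' →* Q),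
      R'.Finite ∧ Presents R' φ' ∧ ∀ l, 2 ^ k * dehn R l ≤ dehn R' l := by
  induction k with
  | zero => exact ⟨X, inferInstance, R, φ, hR, h, fun l => by simp⟩
  | succ k ih =>
    obtain ⟨X₁, _, R₁, φ₁, hR₁, h₁, hle₁⟩ := ih
    obtain ⟨X₂, hX₂, R₂, φ₂, hR₂, h₂, hle₂⟩ := h₁.exists_two_mul_dehn_le hR₁
    refine ⟨X₂, hX₂, R₂, φ₂, hR₂, h₂, fun l => le_trans ?_ (hle₂ l)⟩
    rw [pow_succ', mul_assoc]
    exact Nat.mul_le_mul_left 2 (hle₁ l)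

/-- An isoperimetric function dominates all linear rescalings of a Dehn function with a single
constant, even when it is not monotone. -/
theorem IsIsopFunction.exists_mul_dehn_le {X Q : Type} [Group Q] [Finite X] {α : ℕ → ℕ}
    (hα : IsIsopFunction Q α) {R : Set (FreeGroup X)} {φ : FreeGroup X →* Q} (hR : R.Finite)
    (h : Presents R φ) (A : ℕ) :
    ∃ C, ∀ l, A * dehn R (A * l) + A * l ≤ C * α (C * l + C) + C * l + C := by
  obtain ⟨X₁, _, R₁, φ₁, hR₁, h₁, hle₁⟩ := h.exists_dehn_mul_le hR A
  obtain ⟨X₂, hX₂, R₂, φ₂, hR₂, h₂, hle₂⟩ := h₁.exists_two_pow_mul_dehn_le hR₁ (2 * A)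
  obtain ⟨C, hC⟩ := hα X₂ R₂ φ₂ hX₂ hR₂ h₂
  refine ⟨C, fun l => le_trans ?_ (hC l)⟩
  calc A * dehn R (A * l) + A * l ≤ A * dehn R₁ l + A * dehn R₁ l :=
        Nat.add_le_add (Nat.mul_le_mul_left A (hle₁ l).1) (Nat.mul_le_mul_left A (hle₁ l).2)
    _ = 2 * A * dehn R₁ l := by ring
    _ ≤ 2 ^ (2 * A) * dehn R₁ l := Nat.mul_le_mul_right _ Nat.lt_two_pow_self.le
    _ ≤ dehn R₂ l := hle₂ l

end Presentation

theorem WordLe.fgNorm_le {X : Type*} {w : FreeGroup X} {k : ℕ}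
    (h : WordLe (Set.range FreeGroup.of) w k) : fgNorm w ≤ k := by
  let _ : DecidableEq X := Classical.decEq X
  obtain ⟨l, hl, hmem, rfl⟩ := h
  refine le_trans ?_ hl
  clear hl
  change l.prod.norm ≤ _
  induction l with
  | nil => simp
  | cons x l ih =>
    have hx : x.norm = 1 := by
      rcases hmem x (by simp) with ⟨a, rfl⟩ | ⟨a, ha⟩
      · exact FreeGroup.norm_of a
      · rw [← FreeGroup.norm_inv_eq, ← ha, FreeGroup.norm_of]
    have := ih fun y hy => hmem y (by simp [hy])
    rw [List.prod_cons, List.length_cons]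
    exact (FreeGroup.norm_mul_le _ _).trans (by omega)

theorem exists_wordLe_range_of {X : Type*} (w : FreeGroup X) :
    ∃ k, WordLe (Set.range FreeGroup.of) w k :=
  exists_wordLe_of_mem_closure (by rw [FreeGroup.closure_range_of]; trivial)

section FibreProduct

variable {Γ₁ Γ₂ Q : Type} [Group Γ₁] [Group Γ₂] [Group Q]

/-- A presentation of `Q` on generators `Z` together with lifts of these generators generating
both factors, such that elements of the factors lift to `FreeGroup Z` at a linear cost. -/
theorem exists_presentation_with_lifts (hQ : FinitelyPresentedGroup Q) {p₁ : Γ₁ →* Q}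
    {p₂ : Γ₂ →* Q} (hs₁ : Function.Surjective p₁) (hs₂ : Function.Surjective p₂)
    {T : Set (Γ₁ × Γ₂)} (hT : T.Finite) :
    ∃ (Z : Type) (_ : Finite Z) (R : Set (FreeGroup Z)) (φ : FreeGroup Z →* Q)
      (f₁ : FreeGroup Z →* Γ₁) (f₂ : FreeGroup Z →* Γ₂) (c : ℕ), R.Finite ∧ Presents R φ ∧
      p₁.comp f₁ = φ ∧ p₂.comp f₂ = φ ∧ ∀ g k, WordLe T g k →
        (∃ w, f₁ w = g.1 ∧ WordLe (Set.range FreeGroup.of) w (c * k)) ∧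
        (∃ w, f₂ w = g.2 ∧ WordLe (Set.range FreeGroup.of) w (c * k)) := by
  obtain ⟨X, hX, R₀, φ₀, hR₀, hφ₀⟩ := hQ
  have : Finite T := hT
  have lifts : ∀ {Γ : Type} [Group Γ] (p : Γ →* Q) (π : Γ₁ × Γ₂ →* Γ), Function.Surjective p →
      ∃ (f : FreeGroup (X ⊕ T) →* Γ) (c : ℕ),
        p.comp f = φ₀.comp (FreeGroup.lift (Sum.elim .of fun _ : T => 1)) ∧
        ∀ g k, WordLe T g k → ∃ w, f w = π g ∧ WordLe (Set.range FreeGroup.of) w (c * k) := by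
    intro Γ _ p π hp
    choose a ha using fun x => hp (φ₀ (.of x))
    have hlift : ∀ u, p (FreeGroup.lift a u) = φ₀ u := by
      intro u
      rw [← MonoidHom.comp_apply]
      congr 1
      ext x
      simp [ha]
    choose u hu using fun t : T => hφ₀.1 (p (π t))
    let f : FreeGroup (X ⊕ T) →* Γ :=
      FreeGroup.lift (Sum.elim a fun t => (FreeGroup.lift a (u t))⁻¹ * π t)
    have hf_inl : ∀ v, f (FreeGroup.map Sum.inl v) = FreeGroup.lift a v := by
      intro v
      rw [← MonoidHom.comp_apply]
      congr 1
      ext x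
      simp [f]
    have hgen : ∀ s ∈ π '' T, ∃ k w, f w = s ∧ WordLe (Set.range FreeGroup.of) w k := by
      rintro _ ⟨t, ht, rfl⟩
      obtain ⟨k, hk⟩ := exists_wordLe_range_of
        (FreeGroup.map Sum.inl (u ⟨t, ht⟩) * FreeGroup.of (Sum.inr (⟨t, ht⟩ : T)))
      refine ⟨k, _, ?_, hk⟩
      rw [map_mul, hf_inl]
      simp [f]
    obtain ⟨c, hc⟩ := (hT.image π).exists_uniform_bound
      (fun s k m hkm ⟨w, hw, hk⟩ => ⟨w, hw, hk.mono hkm⟩) hgen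
    refine ⟨f, c, ?_, fun g k hg =>
      WordLe.lift f hc (hg.map π fun t ht => Set.mem_image_of_mem π ht)⟩
    ext z
    rcases z with x | t
    · simp [f, ha]
    · simp [f, hlift, hu]
  obtain ⟨f₁, c₁, hf₁, h₁⟩ := lifts p₁ (MonoidHom.fst Γ₁ Γ₂) hs₁
  obtain ⟨f₂, c₂, hf₂, h₂⟩ := lifts p₂ (MonoidHom.snd Γ₁ Γ₂) hs₂
  refine ⟨X ⊕ T, inferInstance, _, _, f₁, f₂, c₁ + c₂,
    (hR₀.image _).union (Set.finite_range _), hφ₀.adjoin fun _ => 1, hf₁, hf₂,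
    fun g k hg => ⟨?_, ?_⟩⟩
  · obtain ⟨w, hw, hk⟩ := h₁ g k hg
    exact ⟨w, hw, hk.mono (Nat.mul_le_mul_right k (by omega))⟩
  · obtain ⟨w, hw, hk⟩ := h₂ g k hg
    exact ⟨w, hw, hk.mono (Nat.mul_le_mul_right k (by omega))⟩

/-- A finite generating set of the fibre product whose word length is controlled by the area of
null-homotopic words in a finite presentation of `Q`. -/
theorem exists_generators_fibreProduct (hQ : FinitelyPresentedGroup Q) {p₁ : Γ₁ →* Q}
    {p₂ : Γ₂ →* Q} (hs₁ : Function.Surjective p₁) (hs₂ : Function.Surjective p₂)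
    {T : Set (Γ₁ × Γ₂)} (hT : T.Finite) :
    ∃ (S : Set (Γ₁ × Γ₂)) (Z : Type) (_ : Finite Z) (R : Set (FreeGroup Z))
      (φ : FreeGroup Z →* Q) (K : ℕ), S.Finite ∧ S ⊆ fibreProduct p₁ p₂ ∧ R.Finite ∧
      Presents R φ ∧ ∀ g ∈ fibreProduct p₁ p₂, ∀ l, WordLe T g l →
        ∃ w ∈ normalClosure R, fgNorm w ≤ K * l ∧
          ∀ N, ExprOf R w N → WordLe S g (K * N + K * l) := by
  obtain ⟨Z, hZ, R, φ, f₁, f₂, c, hR, hφ, hf₁, hf₂, hT⟩ :=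
    exists_presentation_with_lifts hQ hs₁ hs₂ hT
  let _ : DecidableEq Z := Classical.decEq Z
  let d : FreeGroup Z →* Γ₁ × Γ₂ := f₁.prod f₂
  let j : FreeGroup Z →* Γ₁ × Γ₂ := f₁.prod 1
  let S : Set (Γ₁ × Γ₂) := Set.range (fun z => d (.of z)) ∪ j '' R
  have hd : ∀ z, d (.of z) ∈ S := fun z => .inl ⟨z, rfl⟩
  obtain ⟨K, hK⟩ := exists_wordLe_of_exprOf hR (S := S) (d := d) (j := j) hd
    (fun r hr => .inr ⟨r, hr, rfl⟩) fun u v => by simp [d, j]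
  refine ⟨S, Z, hZ, R, φ, K + 3 * c, (Set.finite_range _).union (hR.image _), ?_, hR, hφ, ?_⟩
  · rintro _ (⟨z, rfl⟩ | ⟨r, hr, rfl⟩)
    · exact DFunLike.congr_fun (hf₁.trans hf₂.symm) (.of z)
    · have : r ∈ φ.ker := hφ.2 ▸ subset_normalClosure hr
      rw [← hf₁] at this
      exact (this : p₁ (f₁ r) = 1).trans (map_one p₂).symm
  · intro g hg l hgl
    obtain ⟨⟨w₁, hw₁, hl₁⟩, w₂, hw₂, hl₂⟩ := hT g l hgl
    have hnorm : fgNorm (w₁ * w₂⁻¹) ≤ c * l + c * l := (hl₁.mul hl₂.inv).fgNorm_le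
    refine ⟨w₁ * w₂⁻¹, ?_, hnorm.trans (by nlinarith), fun N hN => ?_⟩
    · have h₁ : φ w₁ = p₁ g.1 := by rw [← hf₁, ← hw₁]; rfl
      have h₂ : φ w₂ = p₂ g.2 := by rw [← hf₂, ← hw₂]; rfl
      rw [← hφ.2, MonoidHom.mem_ker, map_mul, map_inv, h₁, h₂, mul_inv_eq_one]
      exact hg
    · have hg' : g = j (w₁ * w₂⁻¹) * d w₂ := by
        ext <;> simp [d, j, hw₁, hw₂]
      have hd₂ : WordLe S (d w₂) (c * l) := hl₂.map d (by rintro _ ⟨z, rfl⟩; exact hd z)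
      rw [hg']
      refine ((hK _ _ hN).mul hd₂).mono ?_
      have : (w₁ * w₂⁻¹).norm ≤ c * l + c * l := hnorm
      nlinarith

end FibreProduct

/-- The fibre product of two surjections onto a finitely presented group `Q` from finitely
generated groups is finitely generated, and its distortion in `Γ₁ × Γ₂` is `⪯` any
isoperimetric function of `Q`. -/
theorem fibreProduct_fg_and_distortion
    {Γ₁ Γ₂ Q : Type} [Group Γ₁] [Group Γ₂] [Group Q]
    (hfg₁ : Group.FG Γ₁) (hfg₂ : Group.FG Γ₂) (hfpQ : FinitelyPresentedGroup Q)
    (p₁ : Γ₁ →* Q) (p₂ : Γ₂ →* Q)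
    (hs₁ : Function.Surjective p₁) (hs₂ : Function.Surjective p₂) :
    Group.FG (fibreProduct p₁ p₂) ∧
      ∀ α : ℕ → ℕ, IsIsopFunction Q α →
        ∀ (T : Set (Γ₁ × Γ₂)), T.Finite → Subgroup.closure T = ⊤ →
        ∀ (S : Set (fibreProduct p₁ p₂)), S.Finite → Subgroup.closure S = ⊤ →
          ∃ C : ℕ, ∀ (l : ℕ) (h : fibreProduct p₁ p₂),
            wordLength T (h : Γ₁ × Γ₂) ≤ l →
            wordLength S h ≤ C * α (C * l + C) + C * l + C := by
  classical
  constructor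
  · obtain ⟨A, hA⟩ := hfg₁
    obtain ⟨B, hB⟩ := hfg₂
    obtain ⟨T, hT⟩ : (⊤ : Subgroup (Γ₁ × Γ₂)).FG := by
      have : Group.FG Γ₁ := ⟨A, hA⟩
      have : Group.FG Γ₂ := ⟨B, hB⟩
      exact Group.FG.out
    obtain ⟨S, Z, hZ, R, φ, K, hS, hSP, hR, hφ, h⟩ :=
      exists_generators_fibreProduct hfpQ hs₁ hs₂ T.finite_toSet
    rw [Group.fg_iff_subgroup_fg, Subgroup.fg_iff]
    refine ⟨S, le_antisymm ((closure_le _).2 hSP) fun g hg => ?_, hS⟩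
    obtain ⟨w, hw, -, hwS⟩ := h g hg _ (wordLe_wordLength hT g)
    exact (hwS _ (exprOf_area hw)).mem_closure
  · intro α hα T hT hTgen U hU hUgen
    obtain ⟨S, Z, hZ, R, φ, K, hS, hSP, hR, hφ, h⟩ :=
      exists_generators_fibreProduct hfpQ hs₁ hs₂ hT
    obtain ⟨c, hc⟩ := hS.exists_uniform_bound
      (p := fun s k => ∃ p, (fibreProduct p₁ p₂).subtype p = s ∧ WordLe U p k)
      (fun s k m hkm ⟨w, hw, hk⟩ => ⟨w, hw, hk.mono hkm⟩)
      fun s hs => ⟨_, ⟨s, hSP hs⟩, rfl, wordLe_wordLength hUgen _⟩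
    obtain ⟨C, hC⟩ := hα.exists_mul_dehn_le hR hφ (c * K + K)
    refine ⟨C, fun l g hg => le_trans ?_ (hC l)⟩
    obtain ⟨w, hw, hwl, hwS⟩ := h g g.2 l ((wordLe_wordLength hTgen _).mono hg)
    have hN : area R w ≤ dehn R ((c * K + K) * l) :=
      area_le_dehn hw (hwl.trans (Nat.mul_le_mul_right l (Nat.le_add_left K _)))
    obtain ⟨p, hp, hpU⟩ := WordLe.lift _ hc (hwS _ (exprOf_area hw))
    obtain rfl : p = g := Subtype.ext hp
    calc wordLength U p ≤ c * (K * area R w + K * l) := hpU.wordLength_le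
      _ = c * K * area R w + c * K * l := by ring
      _ ≤ (c * K + K) * dehn R ((c * K + K) * l) + (c * K + K) * l := by
        gcongr <;> exact Nat.le_add_right _ _
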